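/- For every modal formula A, there exists an adequate A-removing mapping, i.e., a non-expansive map u : P × P → P that sends every cut pair with cut formula A to an ∞-proof of its cut result and satisfies u(π,τ) ∈ P_n whenever π,τ ∈ P_n, for all n. -/

import Mathlib

inductive Formula : Type
  | atom : ℕ → Formula
  | bot  : Formula
  | imp  : Formula → Formula → Formula
  | box  : Formula → Formula
deriving DecidableEq

def boxtimes (Γ : Multiset Formula) : Multiset Formula := Γ + Γ.map Formula.box

inductive GoSeq : Bool → Multiset Formula → Multiset Formula → Prop
  | ax (c) (Γ Δ : Multiset Formula) (A : Formula) : GoSeq c (A ::ₘ Γ) (A ::ₘ Δ)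
  | axBot (c) (Γ Δ : Multiset Formula) : GoSeq c (Formula.bot ::ₘ Γ) Δ
  | impL (c) (Γ Δ : Multiset Formula) (A B : Formula) :
      GoSeq c (B ::ₘ Γ) Δ → GoSeq c Γ (A ::ₘ Δ) → GoSeq c ((A.imp B) ::ₘ Γ) Δ
  | impR (c) (Γ Δ : Multiset Formula) (A B : Formula) :
      GoSeq c (A ::ₘ Γ) (B ::ₘ Δ) → GoSeq c Γ ((A.imp B) ::ₘ Δ)
  | boxGo (c) (Γ Δ Θ : Multiset Formula) (A : Formula) :
      GoSeq c ((Formula.box (A.imp (Formula.box A))) ::ₘ boxtimes Θ) {A} →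
      GoSeq c (Γ + Θ.map Formula.box) ((Formula.box A) ::ₘ Δ)
  | cut (Γ Δ : Multiset Formula) (A : Formula) :
      GoSeq true Γ (A ::ₘ Δ) → GoSeq true (A ::ₘ Γ) Δ → GoSeq true Γ Δ

inductive Frag : Bool → ℕ → Multiset Formula → Multiset Formula → Type
  | hole (c) (Γ Δ : Multiset Formula) : Frag c 0 Γ Δ
  | axP (c) (n) (Γ Δ : Multiset Formula) (p : ℕ) :
      Frag c (n+1) (Formula.atom p ::ₘ Γ) (Formula.atom p ::ₘ Δ)
  | axBot (c) (n) (Γ Δ : Multiset Formula) : Frag c (n+1) (Formula.bot ::ₘ Γ) Δ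
  | impL (c) (n) (Γ Δ : Multiset Formula) (A B : Formula) :
      Frag c (n+1) (B ::ₘ Γ) Δ → Frag c (n+1) Γ (A ::ₘ Δ) →
      Frag c (n+1) ((A.imp B) ::ₘ Γ) Δ
  | impR (c) (n) (Γ Δ : Multiset Formula) (A B : Formula) :
      Frag c (n+1) (A ::ₘ Γ) (B ::ₘ Δ) → Frag c (n+1) Γ ((A.imp B) ::ₘ Δ)
  | box (c) (n) (Γ Δ Θ : Multiset Formula) (l : List Formula) (h : l ≠ []) :
      Frag c (n+1) (boxtimes Θ) (boxtimes (↑l)) →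
      ((i : Fin l.length) → Frag c n (boxtimes Θ) {l.get i}) →
      Frag c (n+1) (Γ + Θ.map Formula.box) ((↑(l.map Formula.box) : Multiset Formula) + Δ)
  | cut (n) (Γ Δ : Multiset Formula) (A : Formula) :
      Frag true (n+1) Γ (A ::ₘ Δ) → Frag true (n+1) (A ::ₘ Γ) Δ → Frag true (n+1) Γ Δ

def Frag.trunc : ∀ {c : Bool} {n : ℕ} {Γ Δ : Multiset Formula}, Frag c (n+1) Γ Δ → Frag c n Γ Δ
  | c, 0, Γ, Δ, _ => .hole c Γ Δ
  | c, n+1, _, _, .axP _ _ Γ Δ p => .axP c n Γ Δ p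
  | c, n+1, _, _, .axBot _ _ Γ Δ => .axBot c n Γ Δ
  | c, n+1, _, _, .impL _ _ Γ Δ A B a b => .impL c n Γ Δ A B a.trunc b.trunc
  | c, n+1, _, _, .impR _ _ Γ Δ A B a => .impR c n Γ Δ A B a.trunc
  | c, n+1, _, _, .box _ _ Γ Δ Θ l h a bs => .box c n Γ Δ Θ l h a.trunc (fun i => (bs i).trunc)
  | _, n+1, _, _, .cut _ Γ Δ A a b => .cut n Γ Δ A a.trunc b.trunc

def Frag.height : ∀ {c : Bool} {n : ℕ} {Γ Δ : Multiset Formula}, Frag c n Γ Δ → ℕ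
  | _, _, _, _, .hole _ _ _ => 0
  | _, _, _, _, .axP _ _ _ _ _ => 0
  | _, _, _, _, .axBot _ _ _ _ => 0
  | _, _, _, _, .impL _ _ _ _ _ _ a b => max a.height b.height + 1
  | _, _, _, _, .impR _ _ _ _ _ _ a => a.height + 1
  | _, _, _, _, .box _ _ _ _ _ _ _ a bs =>
      max a.height (Finset.univ.sup fun i => (bs i).height) + 1
  | _, _, _, _, .cut _ _ _ _ a b => max a.height b.height + 1

def Frag.cutFree : ∀ {c : Bool} {n : ℕ} {Γ Δ : Multiset Formula}, Frag c n Γ Δ → Prop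
  | _, _, _, _, .hole _ _ _ => True
  | _, _, _, _, .axP _ _ _ _ _ => True
  | _, _, _, _, .axBot _ _ _ _ => True
  | _, _, _, _, .impL _ _ _ _ _ _ a b => a.cutFree ∧ b.cutFree
  | _, _, _, _, .impR _ _ _ _ _ _ a => a.cutFree
  | _, _, _, _, .box _ _ _ _ _ _ _ a bs => a.cutFree ∧ ∀ i, (bs i).cutFree
  | _, _, _, _, .cut _ _ _ _ _ _ => False

structure InfProof (c : Bool) (Γ Δ : Multiset Formula) : Type where
  frag : ∀ n : ℕ, Frag c n Γ Δ
  compat : ∀ n : ℕ, (frag (n+1)).trunc = frag n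

structure PP : Type where
  Γ : Multiset Formula
  Δ : Multiset Formula
  prf : InfProof true Γ Δ

def Sim : ℕ → PP → PP → Prop
  | 0, _, _ => True
  | n+1, π, τ => π.Γ = τ.Γ ∧ π.Δ = τ.Δ ∧ HEq (π.prf.frag (n+1)) (τ.prf.frag (n+1))

noncomputable def dP (π τ : PP) : ℝ :=
  sInf {r : ℝ | ∃ n : ℕ, Sim n π τ ∧ r = (1/2 : ℝ) ^ n}

def localHeight (π : PP) : ℕ := (π.prf.frag 1).height

def Pmem (n : ℕ) (π : PP) : Prop := (π.prf.frag n).cutFree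

def IsUltrametric {M : Type*} (d : M → M → ℝ) : Prop :=
  (∀ x y, 0 ≤ d x y) ∧ (∀ x y, d x y = 0 ↔ x = y) ∧ (∀ x y, d x y = d y x) ∧
  (∀ x y z, d x z ≤ max (d x y) (d y z))

def cBall {M : Type*} (d : M → M → ℝ) (x : M) (r : ℝ) : Set M := {y | d x y ≤ r}

def SphericallyComplete {M : Type*} (d : M → M → ℝ) : Prop :=
  ∀ (c : ℕ → M) (r : ℕ → ℝ), (∀ n, 0 ≤ r n) →
    (∀ n, cBall d (c (n+1)) (r (n+1)) ⊆ cBall d (c n) (r n)) →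
    ∃ x, ∀ n, x ∈ cBall d (c n) (r n)

def NonExpansive1 (u : PP → PP) : Prop := ∀ π τ, dP (u π) (u τ) ≤ dP π τ

def Adequate1 (u : PP → PP) : Prop := ∀ n π, Pmem n π → Pmem n (u π)

noncomputable def dPm {m : ℕ} (x y : Fin m → PP) : ℝ := ⨆ i, dP (x i) (y i)

def NonExpansiveM {m : ℕ} (u : (Fin m → PP) → PP) : Prop :=
  ∀ x y, dP (u x) (u y) ≤ dPm x y

def Fm (m : ℕ) : Type := {u : (Fin m → PP) → PP // NonExpansiveM u}

def SimF {m : ℕ} (n k : ℕ) (a b : (Fin m → PP) → PP) : Prop :=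
  (∀ x, Sim n (a x) (b x)) ∧
  (∀ x, (∑ i, localHeight (x i)) < k → Sim (n+1) (a x) (b x))

noncomputable def lm {m : ℕ} (a b : (Fin m → PP) → PP) : ℝ :=
  (1/2) * sInf {r : ℝ | ∃ n k : ℕ, SimF n k a b ∧ r = (1/2 : ℝ) ^ n + (1/2 : ℝ) ^ (n + k)}

noncomputable def dP2 (p q : PP × PP) : ℝ := max (dP p.1 q.1) (dP p.2 q.2)

def NonExpansive2 (u : PP × PP → PP) : Prop := ∀ p q, dP (u p) (u q) ≤ dP2 p q

def Adequate2 (u : PP × PP → PP) : Prop :=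
  ∀ n π τ, Pmem n π → Pmem n τ → Pmem n (u (π, τ))

def Removing (A : Formula) (u : PP × PP → PP) : Prop :=
  ∀ (Γ Δ : Multiset Formula) (π τ : PP),
    π.Γ = Γ → π.Δ = A ::ₘ Δ → τ.Γ = A ::ₘ Γ → τ.Δ = Δ →
    (u (π, τ)).Γ = Γ ∧ (u (π, τ)).Δ = Δ

def RA (A : Formula) : Type := {u : PP × PP → PP // NonExpansive2 u ∧ Removing A u}

def SimF2 (n k : ℕ) (a b : PP × PP → PP) : Prop :=
  (∀ p, Sim n (a p) (b p)) ∧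
  (∀ p : PP × PP, localHeight p.1 + localHeight p.2 < k → Sim (n+1) (a p) (b p))

noncomputable def l2 (a b : PP × PP → PP) : ℝ :=
  (1/2) * sInf {r : ℝ | ∃ n k : ℕ, SimF2 n k a b ∧ r = (1/2 : ℝ) ^ n + (1/2 : ℝ) ^ (n + k)}

section Semantics

/-- Kripke models for Go: transitive, with a rank that drops along every step to another world. -/
structure GoModel : Type 1 where
  World : Type
  rel : World → World → Prop
  trans : ∀ {x y z}, rel x y → rel y z → rel x z
  val : World → ℕ → Prop
  rank : World → ℕ
  rank_lt : ∀ {x y}, rel x y → x = y ∨ rank y < rank x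

def GoModel.Forces (M : GoModel) : M.World → Formula → Prop
  | w, .atom p => M.val w p
  | _, .bot => False
  | w, .imp A B => M.Forces w A → M.Forces w B
  | w, .box A => ∀ v, M.rel w v → M.Forces v A

def GoModel.Refutes (M : GoModel) (w : M.World) (Γ Δ : Multiset Formula) : Prop :=
  (∀ A ∈ Γ, M.Forces w A) ∧ ∀ B ∈ Δ, ¬ M.Forces w B

def GoValid (Γ Δ : Multiset Formula) : Prop :=
  ∀ (M : GoModel) (w : M.World), ¬ M.Refutes w Γ Δ

theorem mem_boxtimes {Γ : Multiset Formula} {C : Formula} :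
    C ∈ boxtimes Γ ↔ C ∈ Γ ∨ ∃ B ∈ Γ, Formula.box B = C := by
  simp [boxtimes]

theorem GoModel.forces_boxtimes {M : GoModel} {w v : M.World} {Θ : Multiset Formula}
    (h : ∀ B ∈ Θ, M.Forces w (.box B)) (hr : M.rel w v) : ∀ C ∈ boxtimes Θ, M.Forces v C := by
  intro C hC
  rcases mem_boxtimes.1 hC with hC | ⟨B, hB, rfl⟩
  · exact h C hC v hr
  · exact fun z hz => h B hB z (M.trans hr hz)

theorem Frag.not_refutes {c : Bool} {n : ℕ} {Γ Δ : Multiset Formula} (F : Frag c n Γ Δ)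
    (M : GoModel) (w : M.World) (hw : M.rank w < n) : ¬ M.Refutes w Γ Δ := by
  induction F generalizing w with
  | hole => omega
  | axP c n Γ Δ p =>
    rintro ⟨hΓ, hΔ⟩
    exact hΔ (.atom p) (by simp) (hΓ (.atom p) (by simp))
  | axBot c n Γ Δ =>
    rintro ⟨hΓ, -⟩
    exact hΓ .bot (by simp)
  | impL c n Γ Δ A B a b iha ihb =>
    rintro ⟨hΓ, hΔ⟩
    rw [Multiset.forall_mem_cons] at hΓ
    by_cases hA : M.Forces w A
    · exact iha w hw ⟨Multiset.forall_mem_cons.2 ⟨hΓ.1 hA, hΓ.2⟩, hΔ⟩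
    · exact ihb w hw ⟨hΓ.2, Multiset.forall_mem_cons.2 ⟨hA, hΔ⟩⟩
  | impR c n Γ Δ A B a iha =>
    rintro ⟨hΓ, hΔ⟩
    rw [Multiset.forall_mem_cons] at hΔ
    obtain ⟨hA, hB⟩ := Classical.not_imp.1 hΔ.1
    exact iha w hw ⟨Multiset.forall_mem_cons.2 ⟨hA, hΓ⟩, Multiset.forall_mem_cons.2 ⟨hB, hΔ.2⟩⟩
  | box c n Γ Δ Θ l hl a bs iha ihb =>
    rintro ⟨hΓ, hΔ⟩
    have hΘ : ∀ B ∈ Θ, M.Forces w (.box B) := fun B hB =>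
      hΓ _ (Multiset.mem_add.2 (.inr (Multiset.mem_map_of_mem _ hB)))
    have hbox : ∀ B ∈ l, ¬ M.Forces w (.box B) := fun B hB =>
      hΔ _ (Multiset.mem_add.2 (.inl (by simpa using hB)))
    have hself : ∀ B ∈ l, M.rel w w ∧ ¬ M.Forces w B := by
      intro B hB
      obtain ⟨v, hv⟩ := not_forall.1 (hbox B hB)
      obtain ⟨hr, hvB⟩ := Classical.not_imp.1 hv
      rcases M.rank_lt hr with rfl | hlt
      · exact ⟨hr, hvB⟩
      · obtain ⟨i, rfl⟩ := List.get_of_mem hB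
        exact (ihb i v (by omega) ⟨GoModel.forces_boxtimes hΘ hr, by simpa using hvB⟩).elim
    obtain ⟨B, hB⟩ := List.exists_mem_of_ne_nil l hl
    refine iha w hw ⟨GoModel.forces_boxtimes hΘ (hself B hB).1, fun C hC => ?_⟩
    rcases mem_boxtimes.1 hC with hC | ⟨D, hD, rfl⟩
    · exact (hself C (by simpa using hC)).2
    · exact hbox D (by simpa using hD)
  | cut n Γ Δ A a b iha ihb =>
    rintro ⟨hΓ, hΔ⟩
    by_cases hA : M.Forces w A
    · exact ihb w hw ⟨Multiset.forall_mem_cons.2 ⟨hA, hΓ⟩, hΔ⟩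
    · exact iha w hw ⟨hΓ, Multiset.forall_mem_cons.2 ⟨hA, hΔ⟩⟩

theorem InfProof.valid {c : Bool} {Γ Δ : Multiset Formula} (π : InfProof c Γ Δ) : GoValid Γ Δ :=
  fun M w => (π.frag (M.rank w + 1)).not_refutes M w (Nat.lt_succ_self _)

theorem GoValid.cut {Γ Δ : Multiset Formula} {A : Formula} (h₁ : GoValid Γ (A ::ₘ Δ))
    (h₂ : GoValid (A ::ₘ Γ) Δ) : GoValid Γ Δ := by
  rintro M w ⟨hΓ, hΔ⟩
  by_cases hA : M.Forces w A
  · exact h₂ M w ⟨Multiset.forall_mem_cons.2 ⟨hA, hΓ⟩, hΔ⟩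
  · exact h₁ M w ⟨hΓ, Multiset.forall_mem_cons.2 ⟨hA, hΔ⟩⟩

theorem GoValid.mono {Γ Γ' Δ Δ' : Multiset Formula} (h : GoValid Γ Δ) (hΓ : Γ ⊆ Γ')
    (hΔ : Δ ⊆ Δ') : GoValid Γ' Δ' :=
  fun M w hr => h M w ⟨fun A hA => hr.1 A (hΓ hA), fun B hB => hr.2 B (hΔ hB)⟩

end Semantics

section Glue

variable {ι : Type} (N : ι → GoModel) (root : ∀ i, (N i).World) (refl : Prop)

inductive GlueRel : Option (Σ i, (N i).World) → Option (Σ i, (N i).World) → Prop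
  | loop (h : refl) : GlueRel none none
  | up (i : ι) (y : (N i).World) (h : y = root i ∨ (N i).rel (root i) y) :
      GlueRel none (some ⟨i, y⟩)
  | inside (i : ι) (x y : (N i).World) (h : (N i).rel x y) : GlueRel (some ⟨i, x⟩) (some ⟨i, y⟩)

/-- The disjoint union of the models `N i` below a new world that sees exactly the worlds
`root i`, their successors, and itself if `refl` holds. -/
def glue [Fintype ι] (V : ℕ → Prop) : GoModel where
  World := Option (Σ i, (N i).World)
  rel := GlueRel N root refl
  trans := by
    rintro _ _ _ (⟨h⟩ | ⟨i, y, h⟩ | ⟨i, x, y, h⟩) h'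
    · exact h'
    · rcases h' with _ | _ | ⟨_, _, z, h'⟩
      refine .up i z (.inr ?_)
      rcases h with rfl | h
      · exact h'
      · exact (N i).trans h h'
    · rcases h' with _ | _ | ⟨_, _, z, h'⟩
      exact .inside i x z ((N i).trans h h')
  val
    | none, p => V p
    | some ⟨i, x⟩, p => (N i).val x p
  rank
    | none => (Finset.univ.sup fun i => (N i).rank (root i)) + 1
    | some ⟨i, x⟩ => (N i).rank x
  rank_lt := by
    rintro _ _ (⟨h⟩ | ⟨i, y, h⟩ | ⟨i, x, y, h⟩)
    · exact .inl rfl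
    · right
      have hle : (N i).rank (root i) ≤ Finset.univ.sup fun i => (N i).rank (root i) :=
        Finset.le_sup (f := fun i => (N i).rank (root i)) (Finset.mem_univ i)
      rcases h with rfl | h
      · exact Nat.lt_succ_of_le hle
      · rcases (N i).rank_lt h with rfl | h
        · exact Nat.lt_succ_of_le hle
        · exact Nat.lt_succ_of_le (h.le.trans hle)
    · rcases (N i).rank_lt h with rfl | h
      · exact .inl rfl
      · exact .inr h

theorem glue_forces_some [Fintype ι] (V : ℕ → Prop) (A : Formula) (i : ι) (x : (N i).World) :
    (glue N root refl V).Forces (some ⟨i, x⟩) A ↔ (N i).Forces x A := by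
  induction A generalizing x with
  | atom p => rfl
  | bot => rfl
  | imp A B ihA ihB => exact imp_congr (ihA x) (ihB x)
  | box A ih =>
    constructor
    · intro h v hv
      exact (ih v).1 (h _ (.inside i x v hv))
    · rintro h _ (_ | _ | ⟨_, _, y, hy⟩)
      exact (ih y).2 (h y hy)

end Glue

section Derivations

/-- Cut-free derivations of the main fragment of an ∞-proof: the right premises of a box rule
are only required to satisfy `X`. -/
inductive Der (X : Multiset Formula → Multiset Formula → Prop) :
    Multiset Formula → Multiset Formula → Type
  | axP (Γ Δ : Multiset Formula) (p : ℕ) : Der X (Formula.atom p ::ₘ Γ) (Formula.atom p ::ₘ Δ)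
  | axBot (Γ Δ : Multiset Formula) : Der X (Formula.bot ::ₘ Γ) Δ
  | impL (Γ Δ : Multiset Formula) (A B : Formula) :
      Der X (B ::ₘ Γ) Δ → Der X Γ (A ::ₘ Δ) → Der X ((A.imp B) ::ₘ Γ) Δ
  | impR (Γ Δ : Multiset Formula) (A B : Formula) :
      Der X (A ::ₘ Γ) (B ::ₘ Δ) → Der X Γ ((A.imp B) ::ₘ Δ)
  | box (Γ Δ Θ : Multiset Formula) (l : List Formula) (h : l ≠ []) :
      Der X (boxtimes Θ) (boxtimes (↑l)) →
      ((i : Fin l.length) → X (boxtimes Θ) {l.get i}) →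
      Der X (Γ + Θ.map Formula.box) ((↑(l.map Formula.box) : Multiset Formula) + Δ)

variable {X : Multiset Formula → Multiset Formula → Prop}

def Der.toFrag (c : Bool) (n : ℕ) (f : ∀ Γ Δ, X Γ Δ → Frag c n Γ Δ) :
    ∀ {Γ Δ : Multiset Formula}, Der X Γ Δ → Frag c (n + 1) Γ Δ
  | _, _, .axP Γ Δ p => .axP c n Γ Δ p
  | _, _, .axBot Γ Δ => .axBot c n Γ Δ
  | _, _, .impL Γ Δ A B a b => .impL c n Γ Δ A B (a.toFrag c n f) (b.toFrag c n f)
  | _, _, .impR Γ Δ A B a => .impR c n Γ Δ A B (a.toFrag c n f)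
  | _, _, .box Γ Δ Θ l h a b => .box c n Γ Δ Θ l h (a.toFrag c n f) fun i => f _ _ (b i)

theorem Der.toFrag_trunc (c : Bool) (n : ℕ) (f : ∀ Γ Δ, X Γ Δ → Frag c (n + 1) Γ Δ)
    {Γ Δ : Multiset Formula} (d : Der X Γ Δ) :
    (d.toFrag c (n + 1) f).trunc = d.toFrag c n fun Γ Δ h => (f Γ Δ h).trunc := by
  induction d <;> simp_all [Der.toFrag, Frag.trunc]

theorem Der.toFrag_cutFree (c : Bool) (n : ℕ) (f : ∀ Γ Δ, X Γ Δ → Frag c n Γ Δ)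
    (hf : ∀ Γ Δ h, (f Γ Δ h).cutFree) {Γ Δ : Multiset Formula} (d : Der X Γ Δ) :
    (d.toFrag c n f).cutFree := by
  induction d <;> simp_all [Der.toFrag, Frag.cutFree]

def unfoldFrag (c : Bool) (g : ∀ Γ Δ, X Γ Δ → Der X Γ Δ) :
    ∀ (n : ℕ) (Γ Δ : Multiset Formula), X Γ Δ → Frag c n Γ Δ
  | 0, Γ, Δ, _ => .hole c Γ Δ
  | n + 1, Γ, Δ, h => (g Γ Δ h).toFrag c n (unfoldFrag c g n)

theorem unfoldFrag_trunc (c : Bool) (g : ∀ Γ Δ, X Γ Δ → Der X Γ Δ) (n : ℕ)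
    (Γ Δ : Multiset Formula) (h : X Γ Δ) :
    (unfoldFrag c g (n + 1) Γ Δ h).trunc = unfoldFrag c g n Γ Δ h := by
  induction n generalizing Γ Δ with
  | zero => simp [unfoldFrag, Frag.trunc]
  | succ n ih =>
    rw [unfoldFrag, Der.toFrag_trunc]
    simp only [ih]
    rfl

theorem unfoldFrag_cutFree (c : Bool) (g : ∀ Γ Δ, X Γ Δ → Der X Γ Δ) (n : ℕ)
    (Γ Δ : Multiset Formula) (h : X Γ Δ) : (unfoldFrag c g n Γ Δ h).cutFree := by
  induction n generalizing Γ Δ with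
  | zero => simp [unfoldFrag, Frag.cutFree]
  | succ n ih => exact Der.toFrag_cutFree c n _ ih _

theorem exists_cutFree_infProof (c : Bool) (hX : ∀ Γ Δ, X Γ Δ → Nonempty (Der X Γ Δ))
    {Γ Δ : Multiset Formula} (h : X Γ Δ) :
    ∃ π : InfProof c Γ Δ, ∀ n, (π.frag n).cutFree :=
  ⟨⟨fun n => unfoldFrag c (fun Γ Δ h => (hX Γ Δ h).some) n Γ Δ h,
    fun n => unfoldFrag_trunc c _ n Γ Δ h⟩, fun n => unfoldFrag_cutFree c _ n Γ Δ h⟩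

end Derivations

section Saturation

structure Hintikka (L R : Set Formula) : Prop where
  bot : Formula.bot ∉ L
  atom : ∀ p, Formula.atom p ∈ L → Formula.atom p ∉ R
  impL : ∀ A B, Formula.imp A B ∈ L → B ∈ L ∨ A ∈ R
  impR : ∀ A B, Formula.imp A B ∈ R → A ∈ L ∧ B ∈ R

def Formula.size : Formula → ℕ
  | .atom _ => 1
  | .bot => 1
  | .imp A B => A.size + B.size + 1
  | .box _ => 1

theorem Hintikka.insert_left {L R : Set Formula} (hH : Hintikka L R) {A B : Formula}
    (h : B ∈ L ∨ A ∈ R) : Hintikka (insert (A.imp B) L) R where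
  bot := by simpa using hH.bot
  atom p := by simpa using hH.atom p
  impL C D hCD := by
    rcases hCD with hCD | hCD
    · obtain ⟨rfl, rfl⟩ := Formula.imp.inj hCD
      exact h.imp_left (Set.mem_insert_of_mem _)
    · exact (hH.impL C D hCD).imp_left (Set.mem_insert_of_mem _)
  impR C D hCD := (hH.impR C D hCD).imp_left (Set.mem_insert_of_mem _)

theorem Hintikka.insert_right {L R : Set Formula} (hH : Hintikka L R) {A B : Formula}
    (hA : A ∈ L) (hB : B ∈ R) : Hintikka L (insert (A.imp B) R) where
  bot := hH.bot
  atom p := by simpa using hH.atom p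
  impL C D hCD := (hH.impL C D hCD).imp_right (Set.mem_insert_of_mem _)
  impR C D hCD := by
    rcases hCD with hCD | hCD
    · obtain ⟨rfl, rfl⟩ := Formula.imp.inj hCD
      exact ⟨hA, Set.mem_insert_of_mem _ hB⟩
    · exact (hH.impR C D hCD).imp_right (Set.mem_insert_of_mem _)

/-- An underivable sequent extends to a Hintikka pair all of whose boxed formulas occur in a
single underivable sequent. -/
theorem exists_hintikka {D : Multiset Formula → Multiset Formula → Prop}
    (axP : ∀ Γ Δ p, D (Formula.atom p ::ₘ Γ) (Formula.atom p ::ₘ Δ))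
    (axBot : ∀ Γ Δ, D (Formula.bot ::ₘ Γ) Δ)
    (impL : ∀ Γ Δ A B, D (B ::ₘ Γ) Δ → D Γ (A ::ₘ Δ) → D ((A.imp B) ::ₘ Γ) Δ)
    (impR : ∀ Γ Δ A B, D (A ::ₘ Γ) (B ::ₘ Δ) → D Γ ((A.imp B) ::ₘ Δ))
    {S : Set Formula} (hS : ∀ A B, Formula.imp A B ∈ S → A ∈ S ∧ B ∈ S)
    (Γ Δ : Multiset Formula) (hΓ : ∀ A ∈ Γ, A ∈ S) (hΔ : ∀ A ∈ Δ, A ∈ S) (h : ¬ D Γ Δ) :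
    ∃ (Γ' Δ' : Multiset Formula) (L R : Set Formula), ¬ D Γ' Δ' ∧ Hintikka L R ∧
      (∀ A ∈ Γ, A ∈ L) ∧ (∀ A ∈ Δ, A ∈ R) ∧
      (∀ A ∈ Γ', A ∈ S) ∧ (∀ A ∈ Δ', A ∈ S) ∧
      (∀ A, Formula.box A ∈ L → Formula.box A ∈ Γ') ∧
      (∀ A, Formula.box A ∈ R → Formula.box A ∈ Δ') := by
  induction hN : (Γ.map Formula.size).sum + (Δ.map Formula.size).sum using Nat.strong_induction_on
    generalizing Γ Δ with
  | _ N ih =>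
  subst hN
  by_cases hl : ∃ A B, Formula.imp A B ∈ Γ
  · obtain ⟨A, B, hAB⟩ := hl
    obtain ⟨hA, hB⟩ := hS A B (hΓ _ hAB)
    obtain ⟨Γ, rfl⟩ := Multiset.exists_cons_of_mem hAB
    rw [Multiset.forall_mem_cons] at hΓ
    rcases not_and_or.1 (fun h' => h (impL Γ Δ A B h'.1 h'.2)) with h | h
    · obtain ⟨Γ', Δ', L, R, hD, hH, h₁, h₂, h₃, h₄, h₅, h₆⟩ :=
        ih _ (by simp [Formula.size]) (B ::ₘ Γ) Δ
          (Multiset.forall_mem_cons.2 ⟨hB, hΓ.2⟩) hΔ h rfl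
      rw [Multiset.forall_mem_cons] at h₁
      exact ⟨Γ', Δ', insert (A.imp B) L, R, hD, hH.insert_left (.inl h₁.1),
        Multiset.forall_mem_cons.2
          ⟨Set.mem_insert _ _, fun C hC => Set.mem_insert_of_mem _ (h₁.2 C hC)⟩,
        h₂, h₃, h₄, by simpa using h₅, h₆⟩
    · obtain ⟨Γ', Δ', L, R, hD, hH, h₁, h₂, h₃, h₄, h₅, h₆⟩ :=
        ih _ (by simp [Formula.size]; omega) Γ (A ::ₘ Δ)
          hΓ.2 (Multiset.forall_mem_cons.2 ⟨hA, hΔ⟩) h rfl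
      rw [Multiset.forall_mem_cons] at h₂
      exact ⟨Γ', Δ', insert (A.imp B) L, R, hD, hH.insert_left (.inr h₂.1),
        Multiset.forall_mem_cons.2
          ⟨Set.mem_insert _ _, fun C hC => Set.mem_insert_of_mem _ (h₁ C hC)⟩,
        h₂.2, h₃, h₄, by simpa using h₅, h₆⟩
  by_cases hr : ∃ A B, Formula.imp A B ∈ Δ
  · obtain ⟨A, B, hAB⟩ := hr
    obtain ⟨hA, hB⟩ := hS A B (hΔ _ hAB)
    obtain ⟨Δ, rfl⟩ := Multiset.exists_cons_of_mem hAB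
    rw [Multiset.forall_mem_cons] at hΔ
    obtain ⟨Γ', Δ', L, R, hD, hH, h₁, h₂, h₃, h₄, h₅, h₆⟩ :=
      ih _ (by simp [Formula.size]; omega) (A ::ₘ Γ) (B ::ₘ Δ)
        (Multiset.forall_mem_cons.2 ⟨hA, hΓ⟩) (Multiset.forall_mem_cons.2 ⟨hB, hΔ.2⟩)
        (fun h' => h (impR Γ Δ A B h')) rfl
    rw [Multiset.forall_mem_cons] at h₁ h₂
    exact ⟨Γ', Δ', L, insert (A.imp B) R, hD, hH.insert_right h₁.1 h₂.1, h₁.2,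
      Multiset.forall_mem_cons.2
        ⟨Set.mem_insert _ _, fun C hC => Set.mem_insert_of_mem _ (h₂.2 C hC)⟩,
      h₃, h₄, h₅, by simpa using h₆⟩
  refine ⟨Γ, Δ, {A | A ∈ Γ}, {A | A ∈ Δ}, h, ⟨?_, ?_, ?_, ?_⟩, fun _ h => h, fun _ h => h, hΓ, hΔ,
    fun _ h => h, fun _ h => h⟩
  · intro hb
    obtain ⟨Γ, rfl⟩ := Multiset.exists_cons_of_mem hb
    exact h (axBot Γ Δ)
  · intro p hp hq
    obtain ⟨Γ, rfl⟩ := Multiset.exists_cons_of_mem hp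
    obtain ⟨Δ, rfl⟩ := Multiset.exists_cons_of_mem hq
    exact h (axP Γ Δ p)
  · exact fun A B hAB => (hl ⟨A, B, hAB⟩).elim
  · exact fun A B hAB => (hr ⟨A, B, hAB⟩).elim

end Saturation

section Completeness

def Formula.subformulas : Formula → Finset Formula
  | .atom p => {.atom p}
  | .bot => {.bot}
  | .imp A B => insert (.imp A B) (A.subformulas ∪ B.subformulas)
  | .box A => insert (.box A) A.subformulas

theorem Formula.mem_subformulas_self (A : Formula) : A ∈ A.subformulas := by
  cases A <;> simp [subformulas]

theorem Formula.subformulas_closed {A : Formula} :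
    (∀ B C, Formula.imp B C ∈ A.subformulas → B ∈ A.subformulas ∧ C ∈ A.subformulas) ∧
      ∀ B, Formula.box B ∈ A.subformulas → B ∈ A.subformulas := by
  induction A with
  | atom p => simp [subformulas]
  | bot => simp [subformulas]
  | imp A B ihA ihB =>
    have := A.mem_subformulas_self
    have := B.mem_subformulas_self
    simp only [subformulas, Finset.mem_insert, Finset.mem_union]
    grind
  | box A ih =>
    have := A.mem_subformulas_self
    simp only [subformulas, Finset.mem_insert]
    grind

/-- A Hintikka pair is refuted at a new root placed below countermodels for the boxed formulas on
the right; the root is reflexive or not according to `refl`. -/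
theorem Hintikka.exists_refutes {L R : Set Formula} (hH : Hintikka L R) (refl : Prop)
    (Θ : Multiset Formula) (F : Finset Formula)
    (hΘ : ∀ B, Formula.box B ∈ L → B ∈ Θ)
    (hF : ∀ B ∈ F, ¬ GoValid (boxtimes Θ) {B})
    (hL : refl → ∀ B, Formula.box B ∈ L → B ∈ L)
    (hR : ∀ B, Formula.box B ∈ R → B ∈ F ∨ refl ∧ B ∈ R) :
    ∃ (M : GoModel) (w : M.World),
      (∀ A ∈ L, M.Forces w A) ∧ ∀ A ∈ R, ¬ M.Forces w A := by
  have hF' : ∀ B : F, ∃ (M : GoModel) (w : M.World), M.Refutes w (boxtimes Θ) {B.1} := by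
    rintro ⟨B, hB⟩
    simpa [GoValid] using hF B hB
  choose N root hN using hF'
  have key : ∀ A, (A ∈ L → (glue N root refl fun p => .atom p ∈ L).Forces none A) ∧
      (A ∈ R → ¬ (glue N root refl fun p => .atom p ∈ L).Forces none A) := by
    intro A
    induction A with
    | atom p => exact ⟨fun h => h, fun h h' => hH.atom p h' h⟩
    | bot => exact ⟨fun h => (hH.bot h).elim, fun _ h => h⟩
    | imp A B ihA ihB =>
      refine ⟨fun h hA => ?_, fun h h' => ?_⟩
      · rcases hH.impL A B h with h | h
        · exact ihB.1 h
        · exact (ihA.2 h hA).elim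
      · obtain ⟨hA, hB⟩ := hH.impR A B h
        exact ihB.2 hB (h' (ihA.1 hA))
    | box A ih =>
      refine ⟨?_, fun h h' => ?_⟩
      · rintro h _ (hr | ⟨i, y, hy⟩)
        · exact ih.1 (hL hr A h)
        · refine (glue_forces_some N root refl _ A i y).2 ?_
          rcases hy with rfl | hy
          · exact (hN i).1 A (mem_boxtimes.2 (.inl (hΘ A h)))
          · exact (hN i).1 (.box A) (mem_boxtimes.2 (.inr ⟨A, hΘ A h, rfl⟩)) y hy
      · rcases hR A h with hA | ⟨hr, hA⟩
        · exact (hN ⟨A, hA⟩).2 A (by simp)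
            ((glue_forces_some N root refl _ A ⟨A, hA⟩ _).1 (h' _ (GlueRel.up (⟨A, hA⟩ : F) _ (.inl rfl))))
        · exact ih.2 hA (h' _ (GlueRel.loop hr))
  exact ⟨glue N root refl fun p => .atom p ∈ L, none, fun A => (key A).1, fun A => (key A).2⟩

theorem Der.box_of_finset {X : Multiset Formula → Multiset Formula → Prop}
    {Γ Δ : Multiset Formula} {Θ Λ : Finset Formula} (hΛ : Λ.Nonempty)
    (hΘΓ : ∀ B ∈ Θ, Formula.box B ∈ Γ) (hΛΔ : ∀ B ∈ Λ, Formula.box B ∈ Δ)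
    (hleft : Nonempty (Der X (boxtimes Θ.val) (boxtimes Λ.val)))
    (hright : ∀ B ∈ Λ, X (boxtimes Θ.val) {B}) : Nonempty (Der X Γ Δ) := by
  have hle : ∀ (T : Finset Formula) (U : Multiset Formula), (∀ B ∈ T, Formula.box B ∈ U) →
      T.val.map Formula.box ≤ U := by
    intro T U h
    refine (Multiset.le_iff_subset (T.nodup.map fun _ _ => Formula.box.inj)).2 ?_
    intro C hC
    obtain ⟨B, hB, rfl⟩ := Multiset.mem_map.1 hC
    exact h B hB
  obtain ⟨Γ, rfl⟩ := Multiset.le_iff_exists_add.1 (hle Θ Γ hΘΓ)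
  obtain ⟨Δ, rfl⟩ := Multiset.le_iff_exists_add.1 (hle Λ Δ hΛΔ)
  obtain ⟨d⟩ := hleft
  have hcoe : (↑Λ.toList : Multiset Formula) = Λ.val := Finset.coe_toList Λ
  rw [add_comm, ← hcoe, Multiset.map_coe]
  refine ⟨Der.box Γ Δ Θ.val Λ.toList ?_ (hcoe ▸ d) fun i => hright _ ?_⟩
  · simpa using hΛ.ne_empty
  · exact Finset.mem_toList.1 (List.get_mem _ _)

/-- `Θ₀` and `Λ₀` collect the boxed formulas already treated reflexively on either side. -/
theorem exists_refutes_of_not_der {S : Finset Formula}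
    (hSi : ∀ A B, Formula.imp A B ∈ S → A ∈ S ∧ B ∈ S) (hSb : ∀ A, Formula.box A ∈ S → A ∈ S)
    (Θ₀ Λ₀ : Finset Formula) (Γ Δ : Multiset Formula)
    (hΓS : ∀ A ∈ Γ, A ∈ S) (hΔS : ∀ A ∈ Δ, A ∈ S)
    (hΘ₀ : ∀ A ∈ boxtimes Θ₀.val, A ∈ Γ) (hΛ₀ : ∀ A ∈ boxtimes Λ₀.val, A ∈ Δ)
    (hval : ∀ B ∈ Λ₀, GoValid (boxtimes Θ₀.val) {B}) (h : ¬ Nonempty (Der GoValid Γ Δ)) :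
    ¬ GoValid Γ Δ := by
  classical
  induction hN : (S \ Θ₀).card + (S \ Λ₀).card using Nat.strong_induction_on
    generalizing Θ₀ Λ₀ Γ Δ with
  | _ N ih =>
  subst hN
  obtain ⟨Γ', Δ', L, R, hD, hH, hΓL, hΔR, hΓ'S, hΔ'S, hLΓ, hRΔ⟩ :=
    exists_hintikka (D := fun Γ Δ => Nonempty (Der GoValid Γ Δ)) (S := S)
      (fun Γ Δ p => ⟨.axP Γ Δ p⟩) (fun Γ Δ => ⟨.axBot Γ Δ⟩)
      (fun Γ Δ A B ⟨a⟩ ⟨b⟩ => ⟨.impL Γ Δ A B a b⟩) (fun Γ Δ A B ⟨a⟩ => ⟨.impR Γ Δ A B a⟩)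
      hSi Γ Δ hΓS hΔS h
  set Θ := S.filter fun B => Formula.box B ∈ L
  set Λ := S.filter fun B => Formula.box B ∈ R ∧ GoValid (boxtimes Θ.val) {B}
  set F := S.filter fun B => Formula.box B ∈ R ∧ ¬ GoValid (boxtimes Θ.val) {B}
  have hΘS : Θ ⊆ S := Finset.filter_subset _ S
  have hΛS : Λ ⊆ S := Finset.filter_subset _ S
  have hLS : ∀ B, Formula.box B ∈ L → B ∈ Θ := fun B hB =>
    Finset.mem_filter.2 ⟨hSb B (hΓ'S _ (hLΓ B hB)), hB⟩
  have hRS : ∀ B, Formula.box B ∈ R → B ∈ F ∨ B ∈ Λ := fun B hB => by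
    have := hSb B (hΔ'S _ (hRΔ B hB))
    by_cases hv : GoValid (boxtimes Θ.val) {B}
    · exact .inr (Finset.mem_filter.2 ⟨this, hB, hv⟩)
    · exact .inl (Finset.mem_filter.2 ⟨this, hB, hv⟩)
  have hΘsub : Θ₀ ⊆ Θ := fun B hB =>
    hLS B (hΓL _ (hΘ₀ _ (mem_boxtimes.2 (.inr ⟨B, hB, rfl⟩))))
  have hmono : boxtimes Θ₀.val ⊆ boxtimes Θ.val := by
    intro C hC
    exact mem_boxtimes.2 ((mem_boxtimes.1 hC).imp (fun h => hΘsub h)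
      fun ⟨B, hB, hBC⟩ => ⟨B, hΘsub hB, hBC⟩)
  have hΛsub : Λ₀ ⊆ Λ := fun B hB => by
    have hBR := hΔR _ (hΛ₀ _ (mem_boxtimes.2 (.inr ⟨B, hB, rfl⟩)))
    exact Finset.mem_filter.2 ⟨hSb B (hΔ'S _ (hRΔ B hBR)), hBR,
      (hval B hB).mono hmono (Multiset.Subset.refl _)⟩
  have refuted : ∀ refl : Prop, (refl → ∀ B, Formula.box B ∈ L → B ∈ L) →
      (∀ B ∈ Λ, refl ∧ B ∈ R) → ¬ GoValid Γ Δ := by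
    intro refl hl hr hv
    obtain ⟨M, w, h₁, h₂⟩ := hH.exists_refutes refl Θ.val F hLS
      (fun B hB => (Finset.mem_filter.1 hB).2.2) hl (fun B hB => (hRS B hB).imp_right (hr B))
    exact hv M w ⟨fun A hA => h₁ A (hΓL A hA), fun A hA => h₂ A (hΔR A hA)⟩
  by_cases heq : Θ = Θ₀ ∧ Λ = Λ₀
  · refine refuted True (fun _ B hB => hΓL B (hΘ₀ B (mem_boxtimes.2 (.inl ?_))))
      fun B hB => ⟨trivial, hΔR B (hΛ₀ B (mem_boxtimes.2 (.inl ?_)))⟩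
    · exact heq.1 ▸ hLS B hB
    · exact heq.2 ▸ hB
  rcases Λ.eq_empty_or_nonempty with hemp | ⟨B, hB⟩
  · exact refuted False False.elim (by simp [hemp])
  · exfalso
    have hboxS : ∀ (T : Finset Formula) (U : Multiset Formula), T ⊆ S → (∀ A ∈ U, A ∈ S) →
        (∀ B ∈ T, Formula.box B ∈ U) → ∀ A ∈ boxtimes T.val, A ∈ S := by
      intro T U hT hU hTU A hA
      rcases mem_boxtimes.1 hA with hA | ⟨B, hB, rfl⟩
      · exact hT hA
      · exact hU _ (hTU B hB)
    have hΘΓ : ∀ B ∈ Θ, Formula.box B ∈ Γ' := fun B hB => hLΓ B (Finset.mem_filter.1 hB).2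
    have hΛΔ : ∀ B ∈ Λ, Formula.box B ∈ Δ' := fun B hB => hRΔ B (Finset.mem_filter.1 hB).2.1
    have hΛval : ∀ B ∈ Λ, GoValid (boxtimes Θ.val) {B} := fun B hB =>
      (Finset.mem_filter.1 hB).2.2
    have hcard : (S \ Θ).card + (S \ Λ).card < (S \ Θ₀).card + (S \ Λ₀).card := by
      have h₁ := Finset.card_sdiff_add_card_eq_card hΘS
      have h₂ := Finset.card_sdiff_add_card_eq_card hΛS
      have h₃ := Finset.card_sdiff_add_card_eq_card (hΘsub.trans hΘS)
      have h₄ := Finset.card_sdiff_add_card_eq_card (hΛsub.trans hΛS)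
      have h₅ := Finset.card_le_card hΘsub
      have h₆ := Finset.card_le_card hΛsub
      have h₇ : ¬ (Θ.card ≤ Θ₀.card ∧ Λ.card ≤ Λ₀.card) := fun hc => heq
        ⟨(Finset.eq_of_subset_of_card_le hΘsub hc.1).symm,
          (Finset.eq_of_subset_of_card_le hΛsub hc.2).symm⟩
      omega
    refine ih _ hcard Θ Λ _ _ (hboxS Θ Γ' hΘS hΓ'S hΘΓ)
      (hboxS Λ Δ' hΛS hΔ'S hΛΔ) (fun _ h => h) (fun _ h => h) hΛval
      (fun hd => hD (Der.box_of_finset ⟨B, hB⟩ hΘΓ hΛΔ hd hΛval)) rfl ?_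
    refine (hΛval B hB).mono (Multiset.Subset.refl _) fun C hC => ?_
    rw [Multiset.mem_singleton.1 hC]
    exact mem_boxtimes.2 (.inl hB)

theorem GoValid.nonempty_der {Γ Δ : Multiset Formula} (h : GoValid Γ Δ) :
    Nonempty (Der GoValid Γ Δ) := by
  classical
  by_contra hd
  have hmem : ∀ A ∈ Γ + Δ, A ∈ (Γ + Δ).toFinset.biUnion Formula.subformulas := fun A hA =>
    Finset.mem_biUnion.2 ⟨A, Multiset.mem_toFinset.2 hA, A.mem_subformulas_self⟩
  refine exists_refutes_of_not_der (S := (Γ + Δ).toFinset.biUnion Formula.subformulas)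
    ?_ ?_ ∅ ∅ Γ Δ (fun A hA => hmem A (Multiset.mem_add.2 (.inl hA)))
    (fun A hA => hmem A (Multiset.mem_add.2 (.inr hA)))
    (by simp [boxtimes]) (by simp [boxtimes]) (by simp) hd h
  · intro A B hAB
    obtain ⟨C, hC, hAB⟩ := Finset.mem_biUnion.1 hAB
    have := Formula.subformulas_closed.1 A B hAB
    exact ⟨Finset.mem_biUnion.2 ⟨C, hC, this.1⟩, Finset.mem_biUnion.2 ⟨C, hC, this.2⟩⟩
  · intro A hA
    obtain ⟨C, hC, hA⟩ := Finset.mem_biUnion.1 hA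
    exact Finset.mem_biUnion.2 ⟨C, hC, Formula.subformulas_closed.2 A hA⟩

theorem GoValid.exists_cutFree {Γ Δ : Multiset Formula} (h : GoValid Γ Δ) :
    ∃ π : InfProof true Γ Δ, ∀ n, (π.frag n).cutFree :=
  exists_cutFree_infProof true (fun _ _ h => h.nonempty_der) h

noncomputable def GoValid.cutFreeProof {Γ Δ : Multiset Formula} (h : GoValid Γ Δ) : PP :=
  ⟨Γ, Δ, h.exists_cutFree.choose⟩

theorem GoValid.cutFreeProof_congr {Γ Γ' Δ Δ' : Multiset Formula} (h : GoValid Γ Δ)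
    (h' : GoValid Γ' Δ') (hΓ : Γ = Γ') (hΔ : Δ = Δ') : h.cutFreeProof = h'.cutFreeProof := by
  subst hΓ hΔ
  rfl

end Completeness

section Distance

theorem dP_le_of_sim {n : ℕ} {π τ : PP} (h : Sim n π τ) : dP π τ ≤ (1 / 2 : ℝ) ^ n :=
  csInf_le ⟨0, by rintro _ ⟨n, -, rfl⟩; positivity⟩ ⟨n, h, rfl⟩

theorem dP_nonneg (π τ : PP) : 0 ≤ dP π τ :=
  Real.sInf_nonneg (by rintro _ ⟨n, -, rfl⟩; positivity)

theorem dP_self (π : PP) : dP π π = 0 := by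
  refine le_antisymm (ge_of_tendsto' (tendsto_pow_atTop_nhds_zero_of_lt_one (r := (1 / 2 : ℝ))
    (by norm_num) (by norm_num)) fun n => dP_le_of_sim ?_) (dP_nonneg π π)
  cases n with
  | zero => trivial
  | succ n => exact ⟨rfl, rfl, HEq.rfl⟩

theorem dP_le_one (π τ : PP) : dP π τ ≤ 1 := by
  simpa using dP_le_of_sim (n := 0) (π := π) (τ := τ) trivial

theorem one_le_dP {π τ : PP} (h : ¬ (π.Γ = τ.Γ ∧ π.Δ = τ.Δ)) : 1 ≤ dP π τ := by
  refine le_csInf ⟨_, 0, trivial, rfl⟩ ?_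
  rintro _ ⟨_ | n, hs, rfl⟩
  · simp
  · exact (h ⟨hs.1, hs.2.1⟩).elim

end Distance

section CutElimination

def IsCutPair (A : Formula) (p : PP × PP) : Prop :=
  p.1.Δ = A ::ₘ p.2.Δ ∧ p.2.Γ = A ::ₘ p.1.Γ

theorem IsCutPair.valid {A : Formula} {p : PP × PP} (h : IsCutPair A p) :
    GoValid p.1.Γ p.2.Δ :=
  GoValid.cut (h.1 ▸ p.1.prf.valid) (h.2 ▸ p.2.prf.valid)

open Classical in
/-- A cut-free ∞-proof of the cut result, chosen independently of the proofs in the cut pair. -/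
noncomputable def cutElim (A : Formula) (p : PP × PP) : PP :=
  if h : GoValid p.1.Γ p.2.Δ ∧ IsCutPair A p then h.1.cutFreeProof
  else p.1

theorem cutElim_of_isCutPair {A : Formula} {p : PP × PP} (h : IsCutPair A p) :
    cutElim A p = h.valid.cutFreeProof :=
  dif_pos ⟨h.valid, h⟩

theorem cutElim_of_not_isCutPair {A : Formula} {p : PP × PP} (h : ¬ IsCutPair A p) :
    cutElim A p = p.1 :=
  dif_neg fun h' => h h'.2

theorem cutElim_nonExpansive (A : Formula) : NonExpansive2 (cutElim A) := by
  intro p q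
  by_cases h₁ : p.1.Γ = q.1.Γ ∧ p.1.Δ = q.1.Δ
  · by_cases h₂ : p.2.Γ = q.2.Γ ∧ p.2.Δ = q.2.Δ
    · by_cases hp : IsCutPair A p
      · have hq : IsCutPair A q := by
          simpa only [IsCutPair, h₁, h₂] using hp
        have heq : cutElim A p = cutElim A q := by
          rw [cutElim_of_isCutPair hp, cutElim_of_isCutPair hq]
          exact GoValid.cutFreeProof_congr _ _ h₁.1 h₂.2
        rw [heq, dP_self]
        exact le_max_of_le_left (dP_nonneg _ _)
      · have hq : ¬ IsCutPair A q := by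
          simpa only [IsCutPair, h₁, h₂] using hp
        rw [cutElim_of_not_isCutPair hp, cutElim_of_not_isCutPair hq]
        exact le_max_left _ _
    · exact le_max_of_le_right ((dP_le_one _ _).trans (one_le_dP h₂))
  · exact le_max_of_le_left ((dP_le_one _ _).trans (one_le_dP h₁))

theorem cutElim_removing (A : Formula) : Removing A (cutElim A) := by
  rintro Γ Δ π τ rfl h₁ h₂ rfl
  rw [cutElim_of_isCutPair ⟨h₁, h₂⟩]
  exact ⟨rfl, rfl⟩

theorem cutElim_adequate (A : Formula) : Adequate2 (cutElim A) := by
  intro n π τ hπ _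
  by_cases h : IsCutPair A (π, τ)
  · rw [cutElim_of_isCutPair h]
    exact h.valid.exists_cutFree.choose_spec n
  · rwa [cutElim_of_not_isCutPair h]

end CutElimination

theorem stmt18 (A : Formula) :
    ∃ u : PP × PP → PP, NonExpansive2 u ∧ Removing A u ∧ Adequate2 u :=
  ⟨cutElim A, cutElim_nonExpansive A, cutElim_removing A, cutElim_adequate A⟩
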